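/- arXiv:2405.19807 — 6 statements merged into one kernel-verified Lean document; each statement's English description precedes it below -/
import Mathlib

section
/- Let p be a transition kernel and let μ = (μ_n)_{n∈[N]} belong to the Bellman-flow set M^p_{μ₀}. Define a policy π by π_n(a|x) = μ_n(x,a) / Σ_{a'∈𝒜} μ_n(x,a') whenever Σ_{a'} μ_n(x,a') > 0, and π_n(·|x) equal to the uniform distribution on 𝒜 otherwise. Then the induced state-action distribution sequence satisfies μ^{π,p} = μ, i.e. μ_n^{π,p}(x,a) = μ_n(x,a) for all n ∈ [N] and (x,a) ∈ 𝒳×𝒜. -/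
open Finset

noncomputable section

/-- Probability simplex on a finite set: nonnegative entries summing to 1. -/
def IsSimplex {Y : Type*} [Fintype Y] (f : Y → ℝ) : Prop :=
  (∀ y, 0 ≤ f y) ∧ ∑ y, f y = 1

/-- A policy `π n x a = π_n(a|x)` has `π_n(·|x)` in the simplex over actions. -/
def IsPolicy {X A : Type*} [Fintype A] (π : ℕ → X → A → ℝ) : Prop :=
  ∀ n x, IsSimplex (π n x)

/-- A transition kernel `p n x a x' = p_n(x'|x,a)` has `p_n(·|x,a)` in the simplex over states. -/
def IsKernel {X A : Type*} [Fintype X] (p : ℕ → X → A → X → ℝ) : Prop :=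
  ∀ n x a, IsSimplex (p n x a)

/-- The state-action distribution sequence `μ^{π,p}` induced by policy `π` in the MDP with
transition kernel `p` and initial distribution `μ0`:
`μ_0 = μ0`, `μ_n(x,a) = Σ_{x',a'} μ_{n-1}(x',a') p_n(x|x',a') π_n(a|x)`. -/
def induced {X A : Type*} [Fintype X] [Fintype A] (μ0 : X × A → ℝ)
    (π : ℕ → X → A → ℝ) (p : ℕ → X → A → X → ℝ) : ℕ → X × A → ℝ
  | 0 => μ0
  | n + 1 => fun xa =>
      ∑ x' : X, ∑ a' : A, induced μ0 π p n (x', a') * p (n + 1) x' a' xa.1 * π (n + 1) xa.1 xa.2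

/-- If `μ = (μ_n)_{n∈[N]}` belongs to the Bellman-flow set `M^p_{μ0}` and the
policy `π` is defined by `π_n(a|x) = μ_n(x,a)/Σ_{a'} μ_n(x,a')` when the normalization is
positive, and uniform over actions otherwise, then the induced state-action distribution
sequence satisfies `μ^{π,p}_n = μ_n` for all `n ∈ [N]`. -/
theorem stmt0 {X A : Type*} [Fintype X] [Fintype A] [Nonempty X] [Nonempty A]
    (N : ℕ) (μ0 : X × A → ℝ) (hμ0 : IsSimplex μ0)
    (p : ℕ → X → A → X → ℝ) (hp : IsKernel p)
    (μ : ℕ → X × A → ℝ)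
    (hinit : μ 0 = μ0)
    (hsimplex : ∀ n ≤ N, IsSimplex (μ n))
    (hflow : ∀ n, 1 ≤ n → n ≤ N → ∀ x' : X,
      ∑ a' : A, μ n (x', a') = ∑ x : X, ∑ a : A, p n x a x' * μ (n - 1) (x, a))
    (π : ℕ → X → A → ℝ)
    (hπ : ∀ n x a, π n x a =
      if 0 < ∑ a' : A, μ n (x, a') then μ n (x, a) / ∑ a' : A, μ n (x, a')
      else 1 / (Fintype.card A : ℝ)) :
    ∀ n ≤ N, ∀ x a, induced μ0 π p n (x, a) = μ n (x, a) := by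
  intro n
  induction n with
  | zero =>
    intro _ x a
    rw [hinit]
    rfl
  | succ n ih =>
    intro hn x a
    have hf := hflow (n + 1) (by omega) hn x
    rw [Nat.add_sub_cancel] at hf
    have h1 : induced μ0 π p (n + 1) (x, a)
        = (∑ a' : A, μ (n + 1) (x, a')) * π (n + 1) x a := by
      rw [hf, Finset.sum_mul]
      simp only [induced]
      refine Finset.sum_congr rfl fun x' _ => ?_
      rw [Finset.sum_mul]
      refine Finset.sum_congr rfl fun a' _ => ?_
      rw [ih (by omega) x' a', mul_comm (μ n (x', a'))]
    have hnn : ∀ a' ∈ (Finset.univ : Finset A), 0 ≤ μ (n + 1) (x, a') :=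
      fun a' _ => (hsimplex (n + 1) hn).1 (x, a')
    rw [h1, hπ]
    split_ifs with h
    · exact mul_div_cancel₀ _ h.ne'
    · have h0 : ∑ a' : A, μ (n + 1) (x, a') = 0 :=
        le_antisymm (not_lt.mp h) (Finset.sum_nonneg hnn)
      have := (Finset.sum_eq_zero_iff_of_nonneg hnn).1 h0 a (Finset.mem_univ a)
      rw [h0, this, zero_mul]

end
end

section
/- For any transition kernel p, the set of state-action distribution sequences induced by policies equals the Bellman-flow set: {μ^{π,p} : π a policy} = M^p_{μ₀}. Consequently, for every function F : (S_{𝒳×𝒜})^N → ℝ, the infimum of F(μ^{π,p}) over all policies π equals the infimum of F(μ) over μ ∈ M^p_{μ₀}. -/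
open Finset

noncomputable section

/-- The set of state-action distribution sequences induced by policies. -/
def inducedSet {X A : Type*} [Fintype X] [Fintype A] (μ0 : X × A → ℝ)
    (p : ℕ → X → A → X → ℝ) (N : ℕ) : Set (Fin (N + 1) → X × A → ℝ) :=
  { f | ∃ π : ℕ → X → A → ℝ, IsPolicy π ∧ ∀ n : Fin (N + 1), f n = induced μ0 π p (n : ℕ) }

/-- The Bellman-flow set `M^p_{μ0}`. -/
def bellmanFlowSet {X A : Type*} [Fintype X] [Fintype A] (μ0 : X × A → ℝ)
    (p : ℕ → X → A → X → ℝ) (N : ℕ) : Set (Fin (N + 1) → X × A → ℝ) :=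
  { f | f 0 = μ0 ∧ (∀ n, IsSimplex (f n)) ∧
      ∀ n : Fin N, ∀ x' : X, ∑ a' : A, f n.succ (x', a')
        = ∑ x : X, ∑ a : A, p ((n : ℕ) + 1) x a x' * f n.castSucc (x, a) }

theorem aux_flow {X A : Type*} [Fintype X] [Fintype A] (μ0 : X × A → ℝ)
    (π : ℕ → X → A → ℝ) (p : ℕ → X → A → X → ℝ) (hπ : IsPolicy π) (n : ℕ) (x' : X) :
    ∑ a' : A, induced μ0 π p (n + 1) (x', a')
      = ∑ x : X, ∑ a : A, p (n + 1) x a x' * induced μ0 π p n (x, a) := by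
  have h : ∀ a' : A, induced μ0 π p (n + 1) (x', a')
      = (∑ x : X, ∑ a : A, p (n + 1) x a x' * induced μ0 π p n (x, a)) * π (n + 1) x' a' := by
    intro a'
    simp only [induced, Finset.sum_mul]
    refine Finset.sum_congr rfl fun x _ => Finset.sum_congr rfl fun a _ => ?_
    ring
  rw [Finset.sum_congr rfl fun a' _ => h a', ← Finset.mul_sum, (hπ (n + 1) x').2, mul_one]

theorem aux_simplex {X A : Type*} [Fintype X] [Fintype A] (μ0 : X × A → ℝ) (hμ0 : IsSimplex μ0)
    (π : ℕ → X → A → ℝ) (p : ℕ → X → A → X → ℝ) (hπ : IsPolicy π) (hp : IsKernel p) (n : ℕ) :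
    IsSimplex (induced μ0 π p n) := by
  induction n with
  | zero => exact hμ0
  | succ n ih =>
    refine ⟨fun y => ?_, ?_⟩
    · exact Finset.sum_nonneg fun x _ => Finset.sum_nonneg fun a _ =>
        mul_nonneg (mul_nonneg (ih.1 _) ((hp _ _ _).1 _)) ((hπ _ _).1 _)
    · rw [Fintype.sum_prod_type, Finset.sum_congr rfl fun x _ => aux_flow μ0 π p hπ n x,
        Finset.sum_comm]
      have h2 := ih.2
      rw [Fintype.sum_prod_type] at h2
      rw [← h2]
      refine Finset.sum_congr rfl fun x _ => ?_
      rw [Finset.sum_comm]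
      refine Finset.sum_congr rfl fun a _ => ?_
      rw [← Finset.sum_mul, (hp _ _ _).2, one_mul]

theorem aux_policy {X A : Type*} [Fintype X] [Fintype A] [Nonempty A] (m : X × A → ℝ)
    (hm : ∀ y, 0 ≤ m y) : ∃ π : X → A → ℝ, (∀ x, IsSimplex (π x)) ∧
      ∀ x a, m (x, a) = (∑ a', m (x, a')) * π x a := by
  have key : ∀ x, ∃ q : A → ℝ, IsSimplex q ∧ ∀ a, m (x, a) = (∑ a', m (x, a')) * q a := by
    intro x
    by_cases h : ∑ a', m (x, a') = 0
    · refine ⟨fun _ => 1 / (Fintype.card A : ℝ), ⟨fun _ => by positivity, ?_⟩, fun a => ?_⟩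
      · simp
      · rw [h, zero_mul]
        exact (Finset.sum_eq_zero_iff_of_nonneg fun a _ => hm (x, a)).1 h a (Finset.mem_univ a)
    · refine ⟨fun a => m (x, a) / ∑ a', m (x, a'), ⟨fun a => ?_, ?_⟩, fun a => ?_⟩
      · exact div_nonneg (hm _) (Finset.sum_nonneg fun _ _ => hm _)
      · rw [← Finset.sum_div, div_self h]
      · field_simp
  choose π h1 h2 using key
  exact ⟨π, h1, h2⟩

theorem aux_eq {X A : Type*} [Fintype X] [Fintype A] [Nonempty A]
    (N : ℕ) (μ0 : X × A → ℝ) (hμ0 : IsSimplex μ0)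
    (p : ℕ → X → A → X → ℝ) (hp : IsKernel p) :
    inducedSet μ0 p N = bellmanFlowSet μ0 p N := by
  ext f
  constructor
  · rintro ⟨π, hπ, hf⟩
    refine ⟨hf 0, fun n => ?_, fun n x' => ?_⟩
    · rw [hf n]
      exact aux_simplex μ0 hμ0 π p hπ hp n
    · rw [hf, hf]
      exact aux_flow μ0 π p hπ n x'
  · rintro ⟨h0, hs, hflow⟩
    have key : ∀ n : ℕ, ∃ q : X → A → ℝ, (∀ x, IsSimplex (q x)) ∧ ∀ h : n < N + 1,
        ∀ x a, f ⟨n, h⟩ (x, a) = (∑ a', f ⟨n, h⟩ (x, a')) * q x a := by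
      intro n
      by_cases h : n < N + 1
      · obtain ⟨q, h1, h2⟩ := aux_policy (f ⟨n, h⟩) (hs _).1
        exact ⟨q, h1, fun _ => h2⟩
      · obtain ⟨q, h1, h2⟩ := aux_policy μ0 hμ0.1
        exact ⟨q, h1, fun h' => absurd h' h⟩
    choose π h1 h2 using key
    refine ⟨π, h1, ?_⟩
    rintro ⟨n, hn⟩
    induction n with
    | zero => exact h0
    | succ n ih =>
      funext ⟨x, a⟩
      have ih' := ih (by omega)
      have hfl := hflow ⟨n, by omega⟩ x
      simp only [Fin.succ_mk, Fin.castSucc_mk] at hfl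
      rw [h2 (n + 1) hn x a, hfl, ih']
      simp only [induced, Finset.sum_mul]
      refine Finset.sum_congr rfl fun x _ => Finset.sum_congr rfl fun a _ => ?_
      ring

/-- For any transition kernel `p`, the set of state-action distribution sequences
induced by policies equals the Bellman-flow set `M^p_{μ0}`; consequently, for every function
`F` on sequences, the infimum of `F(μ^{π,p})` over policies `π` equals the infimum of `F(μ)`
over `μ ∈ M^p_{μ0}`. -/
theorem stmt1 {X A : Type*} [Fintype X] [Fintype A] [Nonempty X] [Nonempty A]
    (N : ℕ) (μ0 : X × A → ℝ) (hμ0 : IsSimplex μ0)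
    (p : ℕ → X → A → X → ℝ) (hp : IsKernel p) :
    inducedSet μ0 p N = bellmanFlowSet μ0 p N ∧
    ∀ F : (Fin (N + 1) → X × A → ℝ) → ℝ,
      sInf (F '' inducedSet μ0 p N) = sInf (F '' bellmanFlowSet μ0 p N) := by
  have h := aux_eq N μ0 hμ0 p hp
  exact ⟨h, fun F => by rw [h]⟩

end
end

section
/- For any policy π, any two transition kernels p = (p_n)_{n∈[N]} and q = (q_n)_{n∈[N]}, and all n ∈ [N]: ‖μ_n^{π,p} − μ_n^{π,q}‖₁ ≤ Σ_{i=0}^{n−1} Σ_{(x,a)∈𝒳×𝒜} μ_i^{π,p}(x,a) · ‖p_{i+1}(·|x,a) − q_{i+1}(·|x,a)‖₁. -/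
open Finset

noncomputable section

/-- L1 distance between two real-valued functions on a finite set. -/
def l1 {Y : Type*} [Fintype Y] (f g : Y → ℝ) : ℝ := ∑ y, |f y - g y|

theorem induced_nonneg_aux {X A : Type*} [Fintype X] [Fintype A]
    (μ0 : X × A → ℝ) (hμ0 : IsSimplex μ0)
    (π : ℕ → X → A → ℝ) (hπ : IsPolicy π)
    (p : ℕ → X → A → X → ℝ) (hp : IsKernel p) (n : ℕ) (xa : X × A) :
    0 ≤ induced μ0 π p n xa := by
  induction n generalizing xa with
  | zero => exact hμ0.1 xa
  | succ n ih =>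
    simp only [induced]
    exact Finset.sum_nonneg fun x _ => Finset.sum_nonneg fun a _ =>
      mul_nonneg (mul_nonneg (ih _) ((hp _ _ _).1 _)) ((hπ _ _).1 _)

theorem induced_step_aux {X A : Type*} [Fintype X] [Fintype A]
    (m m' : X × A → ℝ) (hm : ∀ y, 0 ≤ m y)
    (r : X → A → ℝ) (hr : ∀ x, IsSimplex (r x))
    (P Q : X → A → X → ℝ) (hQ : ∀ x a, IsSimplex (Q x a)) :
    ∑ y : X × A, |(∑ x' : X, ∑ a' : A, m (x', a') * P x' a' y.1 * r y.1 y.2)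
        - ∑ x' : X, ∑ a' : A, m' (x', a') * Q x' a' y.1 * r y.1 y.2|
      ≤ ∑ y : X × A, |m y - m' y| + ∑ x : X, ∑ a : A, m (x, a) * l1 (P x a) (Q x a) := by
  have h1 : ∀ y : X × A, |(∑ x' : X, ∑ a' : A, m (x', a') * P x' a' y.1 * r y.1 y.2)
        - ∑ x' : X, ∑ a' : A, m' (x', a') * Q x' a' y.1 * r y.1 y.2|
      ≤ ∑ z : X × A, (|m z - m' z| * Q z.1 z.2 y.1
          + m z * |P z.1 z.2 y.1 - Q z.1 z.2 y.1|) * r y.1 y.2 := by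
    intro y
    rw [← Fintype.sum_prod_type' (f := fun x' a' => m (x', a') * P x' a' y.1 * r y.1 y.2),
      ← Fintype.sum_prod_type' (f := fun x' a' => m' (x', a') * Q x' a' y.1 * r y.1 y.2),
      ← Finset.sum_sub_distrib]
    refine (Finset.abs_sum_le_sum_abs _ _).trans (Finset.sum_le_sum fun z _ => ?_)
    have e : m (z.1, z.2) * P z.1 z.2 y.1 * r y.1 y.2 - m' (z.1, z.2) * Q z.1 z.2 y.1 * r y.1 y.2
        = ((m z - m' z) * Q z.1 z.2 y.1 + m z * (P z.1 z.2 y.1 - Q z.1 z.2 y.1)) * r y.1 y.2 := by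
      simp only [Prod.mk.eta]; ring
    rw [e, abs_mul, abs_of_nonneg ((hr y.1).1 y.2)]
    refine mul_le_mul_of_nonneg_right ((abs_add_le _ _).trans ?_) ((hr y.1).1 y.2)
    rw [abs_mul, abs_mul, abs_of_nonneg (hm z), abs_of_nonneg ((hQ z.1 z.2).1 y.1)]
  refine (Finset.sum_le_sum fun y _ => h1 y).trans (le_of_eq ?_)
  rw [Finset.sum_comm, ← Fintype.sum_prod_type' (f := fun x a => m (x, a) * l1 (P x a) (Q x a)),
    ← Finset.sum_add_distrib]
  refine Finset.sum_congr rfl fun z _ => ?_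
  rw [Fintype.sum_prod_type]
  simp only [← Finset.mul_sum, (hr _).2, mul_one, Finset.sum_add_distrib, (hQ _ _).2, l1,
    Prod.mk.eta]

/-- For any policy `π`, any two transition kernels `p, q`, and all `n ∈ [N]`:
`‖μ_n^{π,p} − μ_n^{π,q}‖₁ ≤ Σ_{i=0}^{n−1} Σ_{x,a} μ_i^{π,p}(x,a) ‖p_{i+1}(·|x,a) − q_{i+1}(·|x,a)‖₁`. -/
theorem stmt2 {X A : Type*} [Fintype X] [Fintype A] [Nonempty X] [Nonempty A]
    (N : ℕ) (μ0 : X × A → ℝ) (hμ0 : IsSimplex μ0)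
    (π : ℕ → X → A → ℝ) (hπ : IsPolicy π)
    (p q : ℕ → X → A → X → ℝ) (hp : IsKernel p) (hq : IsKernel q) :
    ∀ n ≤ N,
      l1 (induced μ0 π p n) (induced μ0 π q n)
        ≤ ∑ i ∈ Finset.range n, ∑ x : X, ∑ a : A,
            induced μ0 π p i (x, a) * l1 (p (i + 1) x a) (q (i + 1) x a) := by
  intro n _
  clear * - hμ0 hπ hp hq
  induction n with
  | zero => simp [l1, induced]
  | succ n ih =>
    rw [Finset.sum_range_succ]
    have h := induced_step_aux (induced μ0 π p n) (induced μ0 π q n)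
      (induced_nonneg_aux μ0 hμ0 π hπ p hp n) (π (n + 1)) (hπ (n + 1))
      (p (n + 1)) (q (n + 1)) (hq (n + 1))
    exact h.trans (add_le_add_left ih _)

end
end

section
/- (Inverse-Pinsker-type inequality.) Let 𝒳 be a finite set and let p', q' be probability distributions on 𝒳. Define the smoothed distributions p := (p' + u)/2 and q := (q' + u)/2, where u is the uniform distribution on 𝒳 (u(x) = 1/|𝒳| for all x). Then KL(p ‖ q) ≤ 2·|𝒳|·‖p − q‖₁², where KL(p ‖ q) := Σ_{x∈𝒳} p(x) log(p(x)/q(x)) and ‖p − q‖₁ := Σ_{x∈𝒳} |p(x) − q(x)|. -/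
open Finset

noncomputable section

/-- inverse-Pinsker-type inequality: if `p'` and `q'` are probability
distributions on a finite nonempty set `X`, and `p := (p' + u)/2`, `q := (q' + u)/2` with
`u` the uniform distribution on `X`, then
`KL(p ‖ q) ≤ 2 |X| ‖p − q‖₁²`. -/
theorem stmt4 {X : Type*} [Fintype X] [Nonempty X]
    (p' q' : X → ℝ) (hp' : IsSimplex p') (hq' : IsSimplex q')
    (p q : X → ℝ)
    (hp : ∀ x, p x = (p' x + 1 / (Fintype.card X : ℝ)) / 2)
    (hq : ∀ x, q x = (q' x + 1 / (Fintype.card X : ℝ)) / 2) :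
    ∑ x, p x * Real.log (p x / q x)
      ≤ 2 * (Fintype.card X : ℝ) * (∑ x, |p x - q x|) ^ 2 := by
  have hn : (0:ℝ) < (Fintype.card X : ℝ) := by exact_mod_cast Fintype.card_pos
  have key : ∀ x, p x * Real.log (p x / q x)
      ≤ 2 * (Fintype.card X : ℝ) * |p x - q x| ^ 2 + (p x - q x) := by
    intro x
    have hu : 0 < 1 / (Fintype.card X : ℝ) := by positivity
    have h1 := hp'.1 x
    have h2 := hq'.1 x
    have hpx : 0 < p x := by rw [hp]; linarith
    have hqx : 0 < q x := by rw [hq]; linarith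
    have hq2 : 1 ≤ 2 * (Fintype.card X : ℝ) * q x := by
      have h3 : (Fintype.card X : ℝ) * (1 / (Fintype.card X : ℝ)) = 1 := by field_simp
      have h4 := mul_nonneg hn.le h2
      rw [hq]
      nlinarith
    have hl := Real.log_le_sub_one_of_pos (div_pos hpx hqx)
    have e : p x * (p x / q x - 1) = (p x - q x) ^ 2 / q x + (p x - q x) := by
      field_simp
      ring
    have hd : (p x - q x) ^ 2 / q x ≤ 2 * (Fintype.card X : ℝ) * (p x - q x) ^ 2 := by
      rw [div_le_iff₀ hqx]
      nlinarith [mul_le_mul_of_nonneg_right hq2 (sq_nonneg (p x - q x))]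
    rw [sq_abs]
    have := mul_le_mul_of_nonneg_left hl hpx.le
    linarith
  have hz : ∑ x, (p x - q x) = 0 := by
    have h : ∀ x, p x - q x = (p' x - q' x) / 2 := by
      intro x
      rw [hp, hq]
      ring
    simp_rw [h]
    rw [← Finset.sum_div, Finset.sum_sub_distrib, hp'.2, hq'.2]
    norm_num
  have hs : ∑ x, |p x - q x| ^ 2 ≤ (∑ x, |p x - q x|) ^ 2 :=
    Finset.sum_sq_le_sq_sum_of_nonneg (fun x _ => abs_nonneg _)
  calc ∑ x, p x * Real.log (p x / q x)
      ≤ ∑ x, (2 * (Fintype.card X : ℝ) * |p x - q x| ^ 2 + (p x - q x)) :=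
        Finset.sum_le_sum (fun x _ => key x)
    _ = 2 * (Fintype.card X : ℝ) * ∑ x, |p x - q x| ^ 2 := by
        rw [Finset.sum_add_distrib, hz, ← Finset.mul_sum, add_zero]
    _ ≤ _ := mul_le_mul_of_nonneg_left hs (by positivity)

end
end

section
/- (Reduction from sleeping experts to standard learning with expert advice.) Fix a convex decision space 𝒰, experts k ∈ [K], activity signals I^{t,k} ∈ {0,1}, expert predictions u^{t,k} ∈ 𝒰, weight vectors v^t in the simplex on [K] with Σ_{k} I^{t,k} v^{t,k} > 0 for each t, and arbitrary loss functions ℓ^t : 𝒰 → ℝ. Define û^t := (Σ_k I^{t,k} v^{t,k} u^{t,k}) / (Σ_k I^{t,k} v^{t,k}), and modified predictions ũ^{t,k} := u^{t,k} if I^{t,k} = 1 and ũ^{t,k} := û^t if I^{t,k} = 0. Then Σ_k v^{t,k} ũ^{t,k} = û^t for every t, and consequently for every expert k the standard regret on the modified predictions equals the sleeping regret: Σ_{t=1}^T [ℓ^t(Σ_j v^{t,j} ũ^{t,j}) − ℓ^t(ũ^{t,k})] = Σ_{t=1}^T I^{t,k}·[ℓ^t(û^t) − ℓ^t(u^{t,k})].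 -/
open Finset

noncomputable section

/-- reduction from sleeping experts to standard learning with expert advice:
with activity signals `I^{t,k} ∈ {0,1}`, predictions `u^{t,k}` in a convex decision set `U`,
weights `v^t` in the simplex with `Σ_k I^{t,k} v^{t,k} > 0`,
`û^t := (Σ_k I^{t,k} v^{t,k} u^{t,k}) / (Σ_k I^{t,k} v^{t,k})` and modified predictions
`ũ^{t,k} := u^{t,k}` if `I^{t,k} = 1` and `û^t` otherwise, one has
`Σ_k v^{t,k} ũ^{t,k} = û^t` for every `t`, and for every expert `k` the standard regret on
the modified predictions equals the sleeping regret. -/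
theorem stmt8 {V : Type*} [AddCommGroup V] [Module ℝ V]
    (T K : ℕ) (U : Set V) (hU : Convex ℝ U)
    (I : Fin T → Fin K → ℝ) (hI : ∀ t k, I t k = 0 ∨ I t k = 1)
    (u : Fin T → Fin K → V) (hu : ∀ t k, u t k ∈ U)
    (v : Fin T → Fin K → ℝ)
    (hv0 : ∀ t k, 0 ≤ v t k) (hv1 : ∀ t, ∑ k, v t k = 1)
    (hpos : ∀ t, 0 < ∑ k, I t k * v t k)
    (ℓ : Fin T → V → ℝ)
    (uhat : Fin T → V)
    (huhat : ∀ t, uhat t = (∑ k, I t k * v t k)⁻¹ • ∑ k, (I t k * v t k) • u t k)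
    (util : Fin T → Fin K → V)
    (hutil : ∀ t k, util t k = if I t k = 1 then u t k else uhat t) :
    (∀ t, ∑ k, v t k • util t k = uhat t) ∧
    ∀ k, ∑ t, (ℓ t (∑ j, v t j • util t j) - ℓ t (util t k))
        = ∑ t, I t k * (ℓ t (uhat t) - ℓ t (u t k)) := by
  have key : ∀ t, ∑ k, v t k • util t k = uhat t := by
    intro t
    have h1 : ∑ k, (I t k * v t k) • u t k = (∑ k, I t k * v t k) • uhat t := by
      rw [huhat t, smul_smul, mul_inv_cancel₀ (hpos t).ne', one_smul]
    have h2 : ∀ k, v t k • util t k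
        = (I t k * v t k) • u t k + (v t k - I t k * v t k) • uhat t := by
      intro k
      rw [hutil]
      rcases hI t k with h | h <;> simp [h]
    rw [Finset.sum_congr rfl (fun k _ => h2 k), Finset.sum_add_distrib, h1,
      ← Finset.sum_smul, ← add_smul, Finset.sum_sub_distrib, hv1]
    simp
  refine ⟨key, fun k => Finset.sum_congr rfl fun t _ => ?_⟩
  rw [key, hutil]
  rcases hI t k with h | h <;> simp [h]

end
end

section
/- (Lipschitz–convex transfer of kernel estimation error.) Let F : ((ℝ^{𝒳×𝒜})^N) → ℝ satisfy |F(μ) − F(ν)| ≤ L_F · Σ_{n=1}^N ‖μ_n − ν_n‖₁ for all μ, ν. Then for any policy π and any two transition kernels p, q: F(μ^{π,p}) − F(μ^{π,q}) ≤ L_F · Σ_{n=1}^N Σ_{j=1}^{n} Σ_{(x,a)∈𝒳×𝒜} μ_{j−1}^{π,p}(x,a) · ‖p_j(·|x,a) − q_j(·|x,a)‖₁. -/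
open Finset

noncomputable section

lemma induced_nonneg {X A : Type*} [Fintype X] [Fintype A] (μ0 : X × A → ℝ) (hμ0 : IsSimplex μ0)
    (π : ℕ → X → A → ℝ) (hπ : IsPolicy π) (p : ℕ → X → A → X → ℝ) (hp : IsKernel p) (n : ℕ) :
    ∀ xa, 0 ≤ induced μ0 π p n xa := by
  induction n with
  | zero => exact hμ0.1
  | succ n ih =>
    intro xa
    simp only [induced]
    exact Finset.sum_nonneg fun x _ => Finset.sum_nonneg fun a _ =>
      mul_nonneg (mul_nonneg (ih _) ((hp _ _ _).1 _)) ((hπ _ _).1 _)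

lemma l1_step {X A : Type*} [Fintype X] [Fintype A] (μ0 : X × A → ℝ) (hμ0 : IsSimplex μ0)
    (π : ℕ → X → A → ℝ) (hπ : IsPolicy π)
    (p q : ℕ → X → A → X → ℝ) (hp : IsKernel p) (hq : IsKernel q) (n : ℕ) :
    l1 (induced μ0 π p (n + 1)) (induced μ0 π q (n + 1)) ≤
      l1 (induced μ0 π p n) (induced μ0 π q n) + ∑ x : X, ∑ a : A,
          induced μ0 π p n (x, a) * l1 (p (n + 1) x a) (q (n + 1) x a) := by
  have hμ := induced_nonneg μ0 hμ0 π hπ p hp n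
  have e : ∀ f : X × A → ℝ, ∑ x : X, ∑ a : A, f (x, a) = ∑ z, f z :=
    fun f => (Fintype.sum_prod_type f).symm
  set μ := induced μ0 π p n with hμd
  set ν := induced μ0 π q n with hνd
  have key : ∀ xa : X × A, |induced μ0 π p (n + 1) xa - induced μ0 π q (n + 1) xa| ≤
      ∑ z : X × A, (μ z * |p (n + 1) z.1 z.2 xa.1 - q (n + 1) z.1 z.2 xa.1|
        + |μ z - ν z| * q (n + 1) z.1 z.2 xa.1) * π (n + 1) xa.1 xa.2 := by
    intro xa
    simp only [induced, ← hμd, ← hνd]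
    rw [e (fun z => μ z * p (n + 1) z.1 z.2 xa.1 * π (n + 1) xa.1 xa.2),
      e (fun z => ν z * q (n + 1) z.1 z.2 xa.1 * π (n + 1) xa.1 xa.2), ← Finset.sum_sub_distrib]
    refine (Finset.abs_sum_le_sum_abs _ _).trans (Finset.sum_le_sum fun z _ => ?_)
    have h1 : μ z * p (n + 1) z.1 z.2 xa.1 * π (n + 1) xa.1 xa.2
        - ν z * q (n + 1) z.1 z.2 xa.1 * π (n + 1) xa.1 xa.2
        = (μ z * (p (n + 1) z.1 z.2 xa.1 - q (n + 1) z.1 z.2 xa.1)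
          + (μ z - ν z) * q (n + 1) z.1 z.2 xa.1) * π (n + 1) xa.1 xa.2 := by ring
    rw [h1, abs_mul, abs_of_nonneg ((hπ (n + 1) xa.1).1 xa.2)]
    refine mul_le_mul_of_nonneg_right ((abs_add_le _ _).trans ?_) ((hπ (n + 1) xa.1).1 xa.2)
    rw [abs_mul, abs_mul, abs_of_nonneg (hμ z), abs_of_nonneg ((hq (n + 1) z.1 z.2).1 xa.1)]
  rw [e (fun z => μ z * l1 (p (n + 1) z.1 z.2) (q (n + 1) z.1 z.2))]
  unfold l1
  refine (Finset.sum_le_sum fun xa _ => key xa).trans (le_of_eq ?_)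
  rw [Finset.sum_comm, ← Finset.sum_add_distrib]
  refine Finset.sum_congr rfl fun z _ => ?_
  rw [Fintype.sum_prod_type]
  simp only [← Finset.mul_sum, (hπ _ _).2, mul_one]
  rw [Finset.sum_add_distrib, ← Finset.mul_sum, ← Finset.mul_sum, (hq _ _ _).2]
  ring

lemma l1_bound {X A : Type*} [Fintype X] [Fintype A] (μ0 : X × A → ℝ) (hμ0 : IsSimplex μ0)
    (π : ℕ → X → A → ℝ) (hπ : IsPolicy π)
    (p q : ℕ → X → A → X → ℝ) (hp : IsKernel p) (hq : IsKernel q) (n : ℕ) :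
    l1 (induced μ0 π p n) (induced μ0 π q n) ≤ ∑ j ∈ Finset.Icc 1 n, ∑ x : X, ∑ a : A,
          induced μ0 π p (j - 1) (x, a) * l1 (p j x a) (q j x a) := by
  induction n with
  | zero => simp [l1, induced]
  | succ n ih =>
    rw [Finset.sum_Icc_succ_top (by omega)]
    exact (l1_step μ0 hμ0 π hπ p q hp hq n).trans (add_le_add_left ih _)

/-- Lipschitz–convex transfer of kernel estimation error: if
`|F(μ) − F(ν)| ≤ L_F Σ_{n=1}^N ‖μ_n − ν_n‖₁` for all `μ, ν`, then for any policy `π` and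
any two transition kernels `p, q`:
`F(μ^{π,p}) − F(μ^{π,q})
  ≤ L_F Σ_{n=1}^N Σ_{j=1}^n Σ_{x,a} μ_{j−1}^{π,p}(x,a) ‖p_j(·|x,a) − q_j(·|x,a)‖₁`. -/
theorem stmt11 {X A : Type*} [Fintype X] [Fintype A] [Nonempty X] [Nonempty A]
    (N : ℕ) (μ0 : X × A → ℝ) (hμ0 : IsSimplex μ0)
    (LF : ℝ) (hLF : 0 < LF)
    (F : (ℕ → X × A → ℝ) → ℝ)
    (hF : ∀ μ ν : ℕ → X × A → ℝ,
      |F μ - F ν| ≤ LF * ∑ n ∈ Finset.Icc 1 N, l1 (μ n) (ν n))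
    (π : ℕ → X → A → ℝ) (hπ : IsPolicy π)
    (p q : ℕ → X → A → X → ℝ) (hp : IsKernel p) (hq : IsKernel q) :
    F (induced μ0 π p) - F (induced μ0 π q)
      ≤ LF * ∑ n ∈ Finset.Icc 1 N, ∑ j ∈ Finset.Icc 1 n, ∑ x : X, ∑ a : A,
          induced μ0 π p (j - 1) (x, a) * l1 (p j x a) (q j x a) := by
  exact (le_abs_self _).trans ((hF _ _).trans (mul_le_mul_of_nonneg_left
    (Finset.sum_le_sum fun n _ => l1_bound μ0 hμ0 π hπ p q hp hq n) hLF.le))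

end
end
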